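/- Let (ℓ_n)_{n∈ℕ} be a sequence of real numbers with ℓ_n ≥ ℓ_0 for some ℓ_0 > 0, and suppose there exists a constant C > 0 such that for every L > 0 the set {n ∈ ℕ : ℓ_n ≤ L} is finite with cardinality at most C e^{L}. Then the double series ∑_{n∈ℕ} ∑_{m=2}^∞ (1/m) · 1/(e^{m ℓ_n} − 1) converges (the family ((1/m)·1/(e^{m ℓ_n}−1))_{(n,m), m≥2} is summable). -/

import Mathlib

open Real

theorem aux_summable_exp (ℓ : ℕ → ℝ) (ℓ₀ : ℝ) (hℓ₀ : 0 < ℓ₀)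
    (hlb : ∀ n, ℓ₀ ≤ ℓ n) (C : ℝ) (hC : 0 < C)
    (hcount : ∀ L : ℝ, 0 < L → {n : ℕ | ℓ n ≤ L}.Finite ∧
      (Nat.card {n : ℕ // ℓ n ≤ L} : ℝ) ≤ C * Real.exp L) :
    Summable (fun n : ℕ => Real.exp (-2 * ℓ n)) := by
  have hgeo : Summable (fun k : ℕ => C * Real.exp 1 * Real.exp (-(k : ℝ))) :=
    Real.summable_exp_neg_nat.mul_left _
  refine summable_of_sum_le (c := ∑' k : ℕ, C * Real.exp 1 * Real.exp (-(k : ℝ)))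
    (fun n => (Real.exp_pos _).le) ?_
  intro s
  rw [← Finset.sum_fiberwise_of_maps_to
    (g := fun n => ⌊ℓ n⌋₊) (t := s.image (fun n => ⌊ℓ n⌋₊))
    (fun n hn => Finset.mem_image_of_mem _ hn)]
  refine le_trans (Finset.sum_le_sum ?_)
    (hgeo.sum_le_tsum (s.image (fun n => ⌊ℓ n⌋₊)) (fun k _ => by positivity))
  intro k _
  obtain ⟨hfin, hcard⟩ := hcount ((k : ℝ) + 1) (by positivity)
  have h1 : ∀ n ∈ s.filter (fun n => ⌊ℓ n⌋₊ = k),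
      Real.exp (-2 * ℓ n) ≤ Real.exp (-2 * (k : ℝ)) := by
    intro n hn
    have hk := (Finset.mem_filter.1 hn).2
    have : (k : ℝ) ≤ ℓ n := by
      rw [← hk]; exact Nat.floor_le (hℓ₀.le.trans (hlb n))
    exact Real.exp_le_exp.2 (by linarith)
  have h2 : ((s.filter (fun n => ⌊ℓ n⌋₊ = k)).card : ℝ) ≤ C * Real.exp ((k : ℝ) + 1) := by
    refine le_trans ?_ hcard
    have h3 : Nat.card {n : ℕ // ℓ n ≤ (k : ℝ) + 1} = hfin.toFinset.card := by
      rw [← Set.ncard_eq_toFinset_card _ hfin]; rfl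
    rw [h3]
    norm_cast
    refine Finset.card_le_card ?_
    intro n hn
    have hk := (Finset.mem_filter.1 hn).2
    have := Nat.lt_floor_add_one (ℓ n)
    rw [hk] at this
    simpa using this.le
  refine (Finset.sum_le_card_nsmul _ _ _ h1).trans ?_
  rw [nsmul_eq_mul]
  refine (mul_le_mul_of_nonneg_right h2 (Real.exp_pos _).le).trans (le_of_eq ?_)
  rw [mul_assoc, mul_assoc, ← Real.exp_add, ← Real.exp_add]
  congr 2
  ring

/-- If the sequence `(ℓ_n)` is bounded below by some `ℓ₀ > 0` and satisfies the
counting bound `#{n : ℓ_n ≤ L} ≤ C e^{L}`, then the family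
`((1/m) · 1/(e^{m ℓ_n} − 1))_{n ∈ ℕ, m ≥ 2}` is summable. -/
theorem summable_nonprimitive_loop_mass (ℓ : ℕ → ℝ) (ℓ₀ : ℝ) (hℓ₀ : 0 < ℓ₀)
    (hlb : ∀ n, ℓ₀ ≤ ℓ n) (C : ℝ) (hC : 0 < C)
    (hcount : ∀ L : ℝ, 0 < L → {n : ℕ | ℓ n ≤ L}.Finite ∧
      (Nat.card {n : ℕ // ℓ n ≤ L} : ℝ) ≤ C * Real.exp L) :
    Summable (fun p : ℕ × ℕ =>
      (1 / ((p.2 : ℝ) + 2)) * (1 / (Real.exp (((p.2 : ℝ) + 2) * ℓ p.1) - 1))) := by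
  have hA := aux_summable_exp ℓ ℓ₀ hℓ₀ hlb C hC hcount
  have hB : Summable (fun k : ℕ => Real.exp ((k : ℝ) * (-ℓ₀))) :=
    Real.summable_exp_nat_mul_iff.2 (by linarith)
  have hP := (hA.mul_of_nonneg hB (fun n => (Real.exp_pos _).le)
    (fun n => (Real.exp_pos _).le)).mul_left (1 - Real.exp (-ℓ₀))⁻¹
  have hc : 0 < 1 - Real.exp (-ℓ₀) := by
    have : Real.exp (-ℓ₀) < 1 := by rw [← Real.exp_zero]; exact Real.exp_lt_exp.2 (by linarith)
    linarith
  have key : ∀ p : ℕ × ℕ, (1 - Real.exp (-ℓ₀)) * Real.exp (((p.2 : ℝ) + 2) * ℓ p.1) ≤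
      Real.exp (((p.2 : ℝ) + 2) * ℓ p.1) - 1 := by
    intro p
    have h0 := hlb p.1
    have hk : (0 : ℝ) ≤ p.2 := Nat.cast_nonneg _
    have : 1 ≤ Real.exp (-ℓ₀) * Real.exp (((p.2 : ℝ) + 2) * ℓ p.1) := by
      rw [← Real.exp_add]
      exact Real.one_le_exp (by nlinarith)
    linarith
  have hpos : ∀ p : ℕ × ℕ, 0 < (1 - Real.exp (-ℓ₀)) * Real.exp (((p.2 : ℝ) + 2) * ℓ p.1) :=
    fun p => mul_pos hc (Real.exp_pos _)
  refine Summable.of_nonneg_of_le (fun p => ?_) (fun p => ?_) hP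
  · have := (hpos p).trans_le (key p)
    positivity
  · have hk : (0 : ℝ) ≤ p.2 := Nat.cast_nonneg _
    have h0 := hlb p.1
    have h1 : 1 / ((p.2 : ℝ) + 2) ≤ 1 := by
      rw [div_le_one (by positivity)]; linarith
    have h2 := one_div_le_one_div_of_le (hpos p) (key p)
    have h3 : 0 ≤ 1 / (Real.exp (((p.2 : ℝ) + 2) * ℓ p.1) - 1) :=
      one_div_nonneg.2 ((hpos p).trans_le (key p)).le
    refine (mul_le_of_le_one_left h3 h1).trans (h2.trans ?_)
    rw [one_div, mul_inv, ← Real.exp_neg]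
    refine mul_le_mul_of_nonneg_left ?_ (inv_pos.2 hc).le
    rw [← Real.exp_add]
    exact Real.exp_le_exp.2 (by nlinarith)
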